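/- With the parametrization of the parabola-inscribed Poncelet triangle family, the Spieker center (incenter of the medial triangle, equivalently the perimeter centroid) of P₁P₂P₃ lies on a parabola coaxial with the original, with focus ((1−2√2)f, 0) and vertex (f(3/2 − 2√2), 0). In particular, the focus of this locus coincides with the leftmost point (−f − r, 0) of the caustic circle of radius r = 2(√2−1)f centered at (−f, 0). -/

import Mathlib

/-- The side length of a chord of the parabola `x = -y²/(4f)` tangent to the circle of radius
`r` about the focus `(-f, 0)`, when `(b - a) * (4 * f ^ 2 + a * b)` is nonnegative. -/
lemma parabola_chord_length {f r a b : ℝ} (hf : 0 < f) (hr : 0 < r)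
    (htan : r ^ 2 * (16 * f ^ 2 + (a + b) ^ 2) = (4 * f ^ 2 + a * b) ^ 2)
    (hsign : 0 ≤ (b - a) * (4 * f ^ 2 + a * b)) :
    Real.sqrt ((-(a ^ 2) / (4 * f) - -(b ^ 2) / (4 * f)) ^ 2 + (a - b) ^ 2) =
      (b - a) * (4 * f ^ 2 + a * b) / (4 * f * r) := by
  have hsq : (-(a ^ 2) / (4 * f) - -(b ^ 2) / (4 * f)) ^ 2 + (a - b) ^ 2 =
      ((b - a) * (4 * f ^ 2 + a * b) / (4 * f * r)) ^ 2 := by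
    rw [div_pow, mul_pow (b - a), ← htan]
    field_simp
    ring
  rw [hsq, Real.sqrt_sq (by positivity)]

/-- A triangle inscribed in the parabola `x = -y²/(4f)` whose side lengths are proportional to
the signed quantities `(yⱼ - yᵢ) * (4f² + yᵢyⱼ)` has its incenter at the focus, so its perimeter
centroid is determined by the sum of its vertices. -/
lemma parabola_perimeter_centroid {f m a b c : ℝ} (hf : f ≠ 0) {l₁ l₂ l₃ : ℝ}
    (h₁ : l₁ = (c - b) * (4 * f ^ 2 + b * c) / m)
    (h₂ : l₂ = (a - c) * (4 * f ^ 2 + c * a) / m)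
    (h₃ : l₃ = (b - a) * (4 * f ^ 2 + a * b) / m)
    (hl : l₁ + l₂ + l₃ ≠ 0) :
    (l₁ * (-(b ^ 2) / (4 * f) + -(c ^ 2) / (4 * f)) / 2 +
        l₂ * (-(c ^ 2) / (4 * f) + -(a ^ 2) / (4 * f)) / 2 +
        l₃ * (-(a ^ 2) / (4 * f) + -(b ^ 2) / (4 * f)) / 2) / (l₁ + l₂ + l₃) =
      (f - (a ^ 2 + b ^ 2 + c ^ 2) / (4 * f)) / 2 ∧
    (l₁ * (b + c) / 2 + l₂ * (c + a) / 2 + l₃ * (a + b) / 2) / (l₁ + l₂ + l₃) =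
      (a + b + c) / 2 := by
  constructor
  · rw [div_eq_iff hl, h₁, h₂, h₃]
    field_simp
    ring
  · rw [div_eq_iff hl, h₁, h₂, h₃]
    ring

/-- Over the Poncelet triangle family inscribed in the parabola `x = −y²/(4f)`, the Spieker
center (perimeter centroid) lies on a coaxial parabola with focus `c = ((1−2√2)f, 0)` and
vertex `v = (f(3/2 − 2√2), 0)`: it satisfies `Sx = v + Sy²/(4(c − v))`. In particular the
focus coincides with the leftmost point `(−f − r, 0)` of the caustic circle of radius
`r = 2(√2 − 1)f` centered at `(−f, 0)`. -/
theorem spieker_locus_parabola (f y₁ Δ y₂ y₃ : ℝ) (hf : 0 < f)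
    (hΔ : Δ = Real.sqrt (16 * (8 * Real.sqrt 2 - 11) * f ^ 4 + 8 * f ^ 2 * y₁ ^ 2 + y₁ ^ 4))
    (hden : 8 * f ^ 2 * Real.sqrt 2 - 12 * f ^ 2 + y₁ ^ 2 ≠ 0)
    (hy₂ : y₂ = 2 * (1 - Real.sqrt 2) * (4 * f * y₁ + Δ) * f /
      (8 * f ^ 2 * Real.sqrt 2 - 12 * f ^ 2 + y₁ ^ 2))
    (hy₃ : y₃ = 2 * (Real.sqrt 2 - 1) * f * (Δ - 4 * f * y₁) /
      (8 * f ^ 2 * Real.sqrt 2 - 12 * f ^ 2 + y₁ ^ 2))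
    (P₁ P₂ P₃ : ℝ × ℝ) (l₁ l₂ l₃ Sx Sy v c r : ℝ)
    (hP₁ : P₁ = (-(y₁ ^ 2) / (4 * f), y₁))
    (hP₂ : P₂ = (-(y₂ ^ 2) / (4 * f), y₂))
    (hP₃ : P₃ = (-(y₃ ^ 2) / (4 * f), y₃))
    (hl₁ : l₁ = Real.sqrt ((P₂.1 - P₃.1) ^ 2 + (P₂.2 - P₃.2) ^ 2))
    (hl₂ : l₂ = Real.sqrt ((P₃.1 - P₁.1) ^ 2 + (P₃.2 - P₁.2) ^ 2))
    (hl₃ : l₃ = Real.sqrt ((P₁.1 - P₂.1) ^ 2 + (P₁.2 - P₂.2) ^ 2))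
    (hSx : Sx = (l₁ * (P₂.1 + P₃.1) / 2 + l₂ * (P₃.1 + P₁.1) / 2 + l₃ * (P₁.1 + P₂.1) / 2) /
      (l₁ + l₂ + l₃))
    (hSy : Sy = (l₁ * (P₂.2 + P₃.2) / 2 + l₂ * (P₃.2 + P₁.2) / 2 + l₃ * (P₁.2 + P₂.2) / 2) /
      (l₁ + l₂ + l₃))
    (hv : v = f * (3 / 2 - 2 * Real.sqrt 2)) (hc : c = (1 - 2 * Real.sqrt 2) * f)
    (hr : r = 2 * (Real.sqrt 2 - 1) * f) :
    Sx = v + Sy ^ 2 / (4 * (c - v)) ∧ c = -f - r := by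
  have h2 : Real.sqrt 2 ^ 2 = 2 := Real.sq_sqrt (by norm_num)
  have h43 : 4 / 3 < Real.sqrt 2 := Real.lt_sqrt_of_sq_lt (by norm_num)
  obtain ⟨k, hk⟩ : ∃ k, Real.sqrt 2 = 1 + k := ⟨Real.sqrt 2 - 1, by ring⟩
  rw [hk] at h2 h43 hden hy₂ hy₃ hΔ hv hc hr
  have hk2 : k ^ 2 = 1 - 2 * k := by linarith
  have hkpos : 0 < k := by linarith
  have hrpos : 0 < r := by rw [hr]; nlinarith
  have hrk : r = 2 * k * f := by rw [hr]; ring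
  obtain ⟨D, hD⟩ : ∃ D, D = y₁ ^ 2 - 4 * k ^ 2 * f ^ 2 := ⟨_, rfl⟩
  have hDen : 8 * f ^ 2 * (1 + k) - 12 * f ^ 2 + y₁ ^ 2 = D := by
    rw [hD, hk2]; ring
  rw [hDen] at hden hy₂ hy₃
  have hrad : 0 < 16 * (8 * (1 + k) - 11) * f ^ 4 + 8 * f ^ 2 * y₁ ^ 2 + y₁ ^ 4 := by
    have h83 : 0 < 8 * (1 + k) - 11 := by nlinarith
    positivity
  have hΔpos : 0 < Δ := by rw [hΔ]; exact Real.sqrt_pos.mpr hrad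
  have hΔsq : Δ ^ 2 = 16 * (8 * (1 + k) - 11) * f ^ 4 + 8 * f ^ 2 * y₁ ^ 2 + y₁ ^ 4 := by
    rw [hΔ]; exact Real.sq_sqrt hrad.le
  -- Symmetric functions of `y₂`, `y₃`.
  have hsum : y₂ + y₃ = -16 * k * f ^ 2 * y₁ / D := by
    rw [hy₂, hy₃]; ring
  have hdiff : y₃ - y₂ = 4 * k * f * Δ / D := by
    rw [hy₂, hy₃]; ring
  have hprod : y₂ * y₃ = -4 * k ^ 2 * f ^ 2 * (y₁ ^ 2 - (4 + 8 * k) * f ^ 2) / D := by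
    have hfac : 16 * f ^ 2 * y₁ ^ 2 - Δ ^ 2 = -(y₁ ^ 2 - (4 + 8 * k) * f ^ 2) * D := by
      rw [hΔsq, hD]
      linear_combination (-4 * f ^ 2 * y₁ ^ 2 + (32 * k - 48) * f ^ 4) * hk2
    have hmul : y₂ * y₃ = 4 * k ^ 2 * f ^ 2 * (16 * f ^ 2 * y₁ ^ 2 - Δ ^ 2) / D ^ 2 := by
      rw [hy₂, hy₃]; field_simp; ring
    rw [hmul, hfac]
    field_simp
  have hsumD : D * (y₂ + y₃) = -16 * k * f ^ 2 * y₁ := by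
    rw [hsum]; field_simp
  have hprodD : D * (y₂ * y₃) = -4 * k ^ 2 * f ^ 2 * (y₁ ^ 2 - (4 + 8 * k) * f ^ 2) := by
    rw [hprod]; field_simp
  have he2 : y₁ * (y₂ + y₃) + y₂ * y₃ = -(4 + 8 * k) * f ^ 2 := by
    apply mul_left_cancel₀ hden
    linear_combination y₁ * hsumD + hprodD + (4 + 8 * k) * f ^ 2 * hD - 4 * f ^ 2 * y₁ ^ 2 * hk2
  have hpow : 4 * f ^ 2 + y₂ * y₃ = 8 * k * f ^ 2 * (y₁ ^ 2 + 4 * k ^ 2 * f ^ 2) / D := by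
    rw [eq_div_iff hden]
    linear_combination hprodD + 4 * f ^ 2 * hD - 4 * f ^ 2 * y₁ ^ 2 * hk2
  -- Each side is tangent to the circle of radius `r` about the focus.
  have htan₂ : r ^ 2 * (16 * f ^ 2 + (y₁ + y₂) ^ 2) = (4 * f ^ 2 + y₁ * y₂) ^ 2 := by
    rw [hrk]
    linear_combination y₂ ^ 2 * hD - y₂ * hsumD + hprodD +
      (8 * f ^ 2 * y₁ * y₂ + (32 * k + 16) * f ^ 4) * hk2
  have htan₃ : r ^ 2 * (16 * f ^ 2 + (y₃ + y₁) ^ 2) = (4 * f ^ 2 + y₃ * y₁) ^ 2 := by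
    rw [hrk]
    linear_combination y₃ ^ 2 * hD - y₃ * hsumD + hprodD +
      (8 * f ^ 2 * y₁ * y₃ + (32 * k + 16) * f ^ 4) * hk2
  have htan₁ : r ^ 2 * (16 * f ^ 2 + (y₂ + y₃) ^ 2) = (4 * f ^ 2 + y₂ * y₃) ^ 2 := by
    rw [hpow, hsum, hrk]
    field_simp
    rw [hD]; ring
  -- The signed lengths are all positive.
  have hs₁ : 0 < (y₃ - y₂) * (4 * f ^ 2 + y₂ * y₃) := by
    have : (y₃ - y₂) * (4 * f ^ 2 + y₂ * y₃) =
        32 * k ^ 2 * f ^ 3 * Δ * (y₁ ^ 2 + 4 * k ^ 2 * f ^ 2) / D ^ 2 := by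
      rw [hdiff, hpow]; field_simp; ring
    rw [this]
    positivity
  have hs_mul : 0 < (y₁ - y₃) * (4 * f ^ 2 + y₃ * y₁) * ((y₂ - y₁) * (4 * f ^ 2 + y₁ * y₂)) := by
    have hA : (y₁ - y₃) * (y₂ - y₁) =
        -(y₁ ^ 4 + (16 * k - 8 * k ^ 2) * f ^ 2 * y₁ ^ 2 +
          16 * k ^ 2 * (1 + 2 * k) * f ^ 4) / D := by
      rw [eq_div_iff hden]
      linear_combination -y₁ ^ 2 * hD + y₁ * hsumD - hprodD
    have hB : (4 * f ^ 2 + y₃ * y₁) * (4 * f ^ 2 + y₁ * y₂) =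
        -(4 * k ^ 2 * f ^ 2 * (y₁ ^ 2 + 4 * f ^ 2) ^ 2) / D := by
      rw [eq_div_iff hden]
      linear_combination 4 * f ^ 2 * y₁ * hsumD + y₁ ^ 2 * hprodD + 16 * f ^ 4 * hD +
        (32 * k - 16) * f ^ 4 * y₁ ^ 2 * hk2
    have hmid : 0 < 16 * k - 8 * k ^ 2 := by rw [hk2]; linarith
    rw [mul_mul_mul_comm, hA, hB, div_mul_div_comm, neg_mul_neg]
    have : 0 < D * D := mul_self_pos.mpr hden
    positivity
  have hs_add : 0 < (y₁ - y₃) * (4 * f ^ 2 + y₃ * y₁) + (y₂ - y₁) * (4 * f ^ 2 + y₁ * y₂) := by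
    have : (y₁ - y₃) * (4 * f ^ 2 + y₃ * y₁) + (y₂ - y₁) * (4 * f ^ 2 + y₁ * y₂) =
        4 * k * f * Δ * (y₁ ^ 4 + 8 * (3 * k - 1) * f ^ 2 * y₁ ^ 2 + 16 * k ^ 2 * f ^ 4) /
          D ^ 2 := by
      have hC : 4 * f ^ 2 + y₁ * (y₂ + y₃) - y₁ ^ 2 =
          -(y₁ ^ 4 + 8 * (3 * k - 1) * f ^ 2 * y₁ ^ 2 + 16 * k ^ 2 * f ^ 4) / D := by
        rw [eq_div_iff hden]
        linear_combination y₁ * hsumD + (4 * f ^ 2 - y₁ ^ 2) * hD + 4 * f ^ 2 * y₁ ^ 2 * hk2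
      calc _ = -((y₃ - y₂) * (4 * f ^ 2 + y₁ * (y₂ + y₃) - y₁ ^ 2)) := by ring
        _ = _ := by rw [hC, hdiff]; field_simp
    rw [this]
    have : 0 < 3 * k - 1 := by linarith
    positivity
  have hs₂ : 0 < (y₁ - y₃) * (4 * f ^ 2 + y₃ * y₁) := by
    by_contra! h
    exact hs_mul.not_ge (mul_nonpos_of_nonpos_of_nonneg h (by linarith))
  have hs₃ : 0 < (y₂ - y₁) * (4 * f ^ 2 + y₁ * y₂) :=
    (pos_iff_pos_of_mul_pos hs_mul).mp hs₂
  subst hP₁ hP₂ hP₃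
  have hlen₁ := hl₁.trans (parabola_chord_length hf hrpos htan₁ hs₁.le)
  have hlen₂ := hl₂.trans (parabola_chord_length hf hrpos htan₃ hs₂.le)
  have hlen₃ := hl₃.trans (parabola_chord_length hf hrpos htan₂ hs₃.le)
  have hper : l₁ + l₂ + l₃ ≠ 0 := by
    rw [hlen₁, hlen₂, hlen₃]
    positivity
  obtain ⟨hx, hy⟩ := parabola_perimeter_centroid hf.ne' hlen₁ hlen₂ hlen₃ hper
  refine ⟨?_, by rw [hc, hr]; ring⟩
  have hcv : 4 * (c - v) = -(2 * f) := by rw [hc, hv]; ring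
  rw [hSx.trans hx, hSy.trans hy, hcv, hv]
  field_simp
  linear_combination 8 * he2
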